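/- Let (K, ω) be a non-trivial finite abelian group with a non-degenerate alternating bihomomorphism ω : K × K → U(1). Then there exist unique integers d₁, …, dₙ ≥ 2 with d₁ ∣ d₂ ∣ ⋯ ∣ dₙ such that (K, ω) is isomorphic as a symplectic abelian group to (K_D, ω_D), where K_D = (⊕ⱼ ℤ/dⱼℤ) ⊕ (⊕ⱼ ℤ/dⱼℤ) and ω_D((a,b),(u,v)) = exp(2πi Σⱼ (bⱼuⱼ − aⱼvⱼ)/dⱼ). -/

import Mathlib

open scoped Real

noncomputable def zt (d : ℕ) : Additive Circle := Additive.ofMul (Circle.exp (2 * π / d))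

lemma zt_zsmul_eq_zero {d : ℕ} (hd : d ≠ 0) (m : ℤ) : m • zt d = 0 ↔ (d : ℤ) ∣ m := by
  have hd' : (d : ℝ) ≠ 0 := by exact_mod_cast hd
  have : m • zt d = Additive.ofMul (Circle.exp (m * (2 * π / d))) := by
    rw [Circle.exp_intCast_mul]; rfl
  rw [this, ofMul_eq_zero, Circle.exp_eq_one]
  constructor
  · rintro ⟨n, hn⟩
    refine ⟨n, ?_⟩
    have h2 : (m : ℝ) = d * n := by
      field_simp at hn
      have := Real.pi_pos
      nlinarith
    exact_mod_cast h2
  · rintro ⟨n, rfl⟩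
    refine ⟨n, ?_⟩
    push_cast
    field_simp

lemma exists_zsmul_zt {d : ℕ} (hd : d ≠ 0) (c : Additive Circle) (hc : d • c = 0) :
    ∃ m : ℤ, c = m • zt d := by
  have hd' : (d : ℝ) ≠ 0 := by exact_mod_cast hd
  have h1 : (c.toMul) ^ d = 1 := hc
  rw [← Circle.exp_arg c.toMul, ← Circle.exp_natCast_mul, Circle.exp_eq_one] at h1
  obtain ⟨n, hn⟩ := h1
  refine ⟨n, ?_⟩
  have : n • zt d = Additive.ofMul (Circle.exp (n * (2 * π / d))) := by
    rw [Circle.exp_intCast_mul]; rfl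
  rw [this]
  apply Additive.toMul.injective
  rw [toMul_ofMul, ← Circle.exp_arg c.toMul]
  congr 1
  field_simp
  linarith

lemma exists_zt_eq {d : ℕ} (hd : d ≠ 0) (c : Additive Circle) (hc : addOrderOf c = d) :
    ∃ m : ℕ, zt d = m • c := by
  have : NeZero d := ⟨hd⟩
  have h1 : IsPrimitiveRoot (c.toMul) d := by
    rw [← hc]
    exact IsPrimitiveRoot.orderOf c.toMul
  have h2 : IsPrimitiveRoot ((c.toMul : Circle) : ℂ) d :=
    h1.map_of_injective (f := Circle.coeHom) Circle.coe_injective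
  have h3 : (d : ℤ) • zt d = 0 := (zt_zsmul_eq_zero hd _).2 dvd_rfl
  have h4 : ((zt d).toMul) ^ d = 1 := by
    rw [natCast_zsmul] at h3; exact h3
  have h5 : (((zt d).toMul : Circle) : ℂ) ^ d = 1 := by
    rw [← Circle.coe_pow, h4, Circle.coe_one]
  obtain ⟨i, -, hi⟩ := h2.eq_pow_of_pow_eq_one h5
  refine ⟨i, ?_⟩
  apply Additive.toMul.injective
  apply Circle.coe_injective
  rw [← hi]; rfl

lemma exists_top_pair {K : Type} [AddCommGroup K] [Finite K]
    (W : K →+ K →+ Additive Circle)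
    (hnd : ∀ x, (∀ y, W x y = 0) → x = 0) :
    ∃ A B : K, W B A = zt (AddMonoid.exponent K) := by
  have hE : AddMonoid.exponent K ≠ 0 := AddMonoid.exponent_ne_zero_of_finite
  obtain ⟨B, hB⟩ := AddMonoid.exists_addOrderOf_eq_exponent
    (AddMonoid.exponent_ne_zero.1 hE)
  set E := AddMonoid.exponent K with hEdef
  have : Finite (W B).range := Set.finite_coe_iff.2 (Set.finite_range (W B))
  have hne : AddMonoid.exponent (W B).range ≠ 0 := AddMonoid.exponent_ne_zero_of_finite
  obtain ⟨⟨c, y, hy⟩, hc⟩ := AddMonoid.exists_addOrderOf_eq_exponent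
    (AddMonoid.exponent_ne_zero.1 hne)
  set g := AddMonoid.exponent (W B).range with hg
  have hgB : g • B = 0 := by
    apply hnd
    intro z
    rw [map_nsmul, AddMonoidHom.nsmul_apply]
    have := AddMonoid.exponent_nsmul_eq_zero (G := (W B).range) ⟨W B z, z, rfl⟩
    exact congrArg Subtype.val this
  have h1 : E ∣ g := by rw [← hB]; exact addOrderOf_dvd_of_nsmul_eq_zero hgB
  have hc' : addOrderOf c = g := by
    rw [← hc]; exact (AddSubgroup.addOrderOf_mk ..).symm
  have h2 : g ∣ E := by
    rw [← hc', ← hy]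
    apply addOrderOf_dvd_of_nsmul_eq_zero
    rw [← map_nsmul, AddMonoid.exponent_nsmul_eq_zero, map_zero]
  have h3 : g = E := Nat.dvd_antisymm h2 h1
  obtain ⟨m, hm⟩ := exists_zt_eq hE c (hc'.trans h3)
  exact ⟨m • y, B, by rw [map_nsmul, hy, hm]⟩

lemma exists_symplectic_basis (N : ℕ) : ∀ (K : Type) [AddCommGroup K] [Finite K]
    (W : K →+ K →+ Additive Circle) (_ : ∀ x, W x x = 0)
    (_ : ∀ x, (∀ y, W x y = 0) → x = 0) (_ : Nat.card K = N),
    ∃ (n : ℕ) (d : Fin n → ℕ) (A B : Fin n → K),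
      (∀ i, 2 ≤ d i) ∧ (∀ i j, i ≤ j → d i ∣ d j) ∧
      (∀ i, d i • A i = 0) ∧ (∀ i, d i • B i = 0) ∧
      (∀ i j, W (A i) (A j) = 0) ∧ (∀ i j, W (B i) (B j) = 0) ∧
      (∀ i, W (B i) (A i) = zt (d i)) ∧ (∀ i j, i ≠ j → W (B i) (A j) = 0) ∧
      (∀ x, ∃ a b : Fin n → ℤ, x = ∑ i, a i • A i + ∑ i, b i • B i) := by
  induction N using Nat.strong_induction_on with
  | _ N ih =>
  intro K _ _ W halt hnd hN
  rcases subsingleton_or_nontrivial K with hs | hs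
  · refine ⟨0, Fin.elim0, Fin.elim0, Fin.elim0, ?_, ?_, ?_, ?_, ?_, ?_, ?_, ?_, ?_⟩
    pick_goal 9
    swap
    all_goals first | exact fun i => Fin.elim0 i | skip
    intro x
    exact ⟨Fin.elim0, Fin.elim0, Subsingleton.elim _ _⟩
  have hskew : ∀ x y, W x y = - W y x := by
    intro x y
    have := halt (x + y)
    simp only [map_add, AddMonoidHom.add_apply, halt, zero_add, add_zero] at this
    rw [add_comm] at this
    exact eq_neg_of_add_eq_zero_left (by rw [add_comm]; simpa [add_comm] using this)
  obtain ⟨A, B, hAB⟩ := exists_top_pair W hnd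
  have hE : AddMonoid.exponent K ≠ 0 := AddMonoid.exponent_ne_zero_of_finite
  have hE1 : AddMonoid.exponent K ≠ 1 := by
    rw [Ne, AddMonoid.exp_eq_one_iff]
    exact not_subsingleton K
  have hkill : ∀ x : K, AddMonoid.exponent K • x = 0 := AddMonoid.exponent_nsmul_eq_zero
  generalize AddMonoid.exponent K = E at *
  have hBA : W A B = - zt E := by rw [hskew, hAB]
  let P : AddSubgroup K := (W A).ker ⊓ (W B).ker
  have hP : ∀ z, z ∈ P ↔ W A z = 0 ∧ W B z = 0 := by
    intro z; simp [P, AddSubgroup.mem_inf, AddMonoidHom.mem_ker]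
  have hdecomp : ∀ z : K, ∃ (a b : ℤ) (w : P), z = (w : K) + a • A + b • B := by
    intro z
    obtain ⟨m, hm⟩ := exists_zsmul_zt hE (W B z) (by rw [← map_nsmul, hkill, map_zero])
    obtain ⟨n, hn⟩ := exists_zsmul_zt hE (W A z) (by rw [← map_nsmul, hkill, map_zero])
    refine ⟨m, -n, ⟨z - m • A - (-n) • B, ?_⟩, ?_⟩
    · rw [hP]
      simp [map_sub, map_zsmul, halt, hAB, hBA, hm, hn]
    · show z = z - m • A - (-n) • B + m • A + (-n) • B
      abel
  let W' : P →+ P →+ Additive Circle :=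
    AddMonoidHom.mk' (fun x => (W x).comp P.subtype) (by
      intro x y; ext z; simp)
  have hW' : ∀ x y : P, W' x y = W x y := fun x y => rfl
  have hlt : Nat.card P < N := by
    rw [← hN]
    refine lt_of_le_of_ne (Nat.card_le_card_of_injective _ P.subtype_injective) ?_
    intro h
    have htop : P = ⊤ := AddSubgroup.eq_top_of_card_eq P h
    have : A ∈ P := htop ▸ AddSubgroup.mem_top A
    have h0 := ((hP A).1 this).2
    rw [hAB] at h0
    have := (zt_zsmul_eq_zero hE 1).1 (by simpa using h0)
    exact hE1 (by exact_mod_cast Int.eq_one_of_dvd_one (by positivity) this)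
  have hPA : ∀ w : P, W A w = 0 := fun w => ((hP w).1 w.2).1
  have hPB : ∀ w : P, W B w = 0 := fun w => ((hP w).1 w.2).2
  have hPA' : ∀ w : P, W w A = 0 := fun w => by rw [hskew, hPA, neg_zero]
  have hPB' : ∀ w : P, W w B = 0 := fun w => by rw [hskew, hPB, neg_zero]
  obtain ⟨n, d, A', B', h2, hch, hdA, hdB, hAA, hBB, hBA1, hBA2, hgen⟩ :=
    ih _ hlt P W' (fun x => halt x) (by
      intro x hx
      apply Subtype.ext
      apply hnd
      intro y
      obtain ⟨a, b, w, rfl⟩ := hdecomp y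
      have := hx w
      rw [hW'] at this
      simp [map_add, map_zsmul, hPA', hPB', this]) rfl
  have hdE : ∀ i, d i ∣ E := by
    intro i
    have h0 : (E : ℤ) • zt (d i) = 0 := by
      rw [← hBA1 i, hW', natCast_zsmul, ← map_nsmul, hkill, map_zero]
    exact_mod_cast (zt_zsmul_eq_zero (by have := h2 i; omega) _).1 h0
  refine ⟨n + 1, Fin.snoc (α := fun _ => ℕ) d E,
    Fin.snoc (α := fun _ => K) (fun i => (A' i : K)) A,
    Fin.snoc (α := fun _ => K) (fun i => (B' i : K)) B, ?_, ?_, ?_, ?_, ?_, ?_, ?_, ?_, ?_⟩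
  · intro i
    refine Fin.lastCases ?_ (fun i => ?_) i
    · simp; omega
    · simpa using h2 i
  · intro i j
    refine Fin.lastCases ?_ (fun j => ?_) j
    · refine Fin.lastCases ?_ (fun i => ?_) i
      · simp
      · simpa using fun _ => hdE i
    · refine Fin.lastCases ?_ (fun i => ?_) i
      · intro h
        exact absurd h (not_le.2 (Fin.castSucc_lt_last j))
      · intro h
        simpa using hch i j (by simpa using h)
  · intro i
    refine Fin.lastCases ?_ (fun i => ?_) i
    · simp [hkill]
    · simpa using congrArg Subtype.val (hdA i)
  · intro i
    refine Fin.lastCases ?_ (fun i => ?_) i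
    · simp [hkill]
    · simpa using congrArg Subtype.val (hdB i)
  · intro i j
    refine Fin.lastCases ?_ (fun i => ?_) i <;> refine Fin.lastCases ?_ (fun j => ?_) j
    · simp [halt]
    · simp [hPA]
    · simp [hPA']
    · simpa [hW'] using hAA i j
  · intro i j
    refine Fin.lastCases ?_ (fun i => ?_) i <;> refine Fin.lastCases ?_ (fun j => ?_) j
    · simp [halt]
    · simp [hPB]
    · simp [hPB']
    · simpa [hW'] using hBB i j
  · intro i
    refine Fin.lastCases ?_ (fun i => ?_) i
    · simp [hAB]
    · simpa [hW'] using hBA1 i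
  · intro i j
    refine Fin.lastCases ?_ (fun i => ?_) i <;> refine Fin.lastCases ?_ (fun j => ?_) j
    · simp
    · simp [hPB]
    · simp [hPA']
    · intro h
      simpa [hW'] using hBA2 i j (by simpa using h)
  · intro x
    obtain ⟨a, b, w, rfl⟩ := hdecomp x
    obtain ⟨a', b', hw⟩ := hgen w
    refine ⟨Fin.snoc (α := fun _ => ℤ) a' a, Fin.snoc (α := fun _ => ℤ) b' b, ?_⟩
    simp only [Fin.sum_univ_castSucc, Fin.snoc_castSucc, Fin.snoc_last]
    have := congrArg Subtype.val hw
    simp only [AddSubgroup.coe_add, AddSubgroup.val_finsetSum, AddSubgroup.coe_zsmul] at this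
    rw [this]
    abel

lemma card_ker_eq {K : Type} [AddCommGroup K] {n : ℕ} (d : Fin n → ℕ) (hd : ∀ i, 2 ≤ d i)
    (e : K ≃+ (((i : Fin n) → ZMod (d i)) × ((i : Fin n) → ZMod (d i)))) (k : ℕ) :
    Nat.card {x : K // k • x = 0} = (∏ i, (d i).gcd k) ^ 2 := by
  have h1 : ∀ i, Nat.card {x : ZMod (d i) // k • x = 0} = (d i).gcd k := by
    intro i
    have : NeZero (d i) := ⟨by have := hd i; omega⟩
    have := IsAddCyclic.card_nsmulAddMonoidHom_ker (G := ZMod (d i)) k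
    rw [Nat.card_zmod] at this
    exact this
  have h2 : Nat.card {x : (i : Fin n) → ZMod (d i) // k • x = 0} = ∏ i, (d i).gcd k := by
    rw [← Finset.prod_congr rfl (fun i _ => h1 i), ← Nat.card_pi]
    refine Nat.card_congr ?_
    refine (Equiv.subtypeEquivRight fun x => ?_).trans
      (Equiv.subtypePiEquivPi (p := fun i (x : ZMod (d i)) => k • x = 0))
    rw [funext_iff]; rfl
  rw [sq, ← h2, ← Nat.card_prod]
  refine Nat.card_congr ?_
  refine (e.toEquiv.subtypeEquiv (q := fun z => k • z.1 = 0 ∧ k • z.2 = 0) fun x => ?_).trans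
    (Equiv.subtypeProdEquivProd (p := fun z : (i : Fin n) → ZMod (d i) => k • z = 0)
      (q := fun z : (i : Fin n) → ZMod (d i) => k • z = 0))
  rw [← e.map_eq_zero_iff, map_nsmul, Prod.ext_iff]; rfl

lemma len_le {n n' : ℕ} (d : Fin n → ℕ) (d' : Fin n' → ℕ)
    (hd : ∀ i, 2 ≤ d i) (hch : ∀ i j, i ≤ j → d i ∣ d j)
    (h : ∀ k, ∏ i, (d i).gcd k = ∏ i, (d' i).gcd k) : n ≤ n' := by
  rcases n with _ | n
  · exact Nat.zero_le _
  obtain ⟨p, hp, hpd⟩ := Nat.exists_prime_and_dvd (n := d 0) (by have := hd 0; omega)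
  have h1 : ∏ i, (d i).gcd p = p ^ (n + 1) := by
    rw [Finset.prod_congr rfl (fun i _ =>
      Nat.gcd_eq_right (hpd.trans (hch 0 i (Fin.zero_le i))))]
    simp
  have h2 : ∏ i, (d' i).gcd p ≤ p ^ n' := by
    calc ∏ i, (d' i).gcd p ≤ ∏ _i : Fin n', p :=
          Finset.prod_le_prod' fun i _ => Nat.gcd_le_right _ hp.pos
      _ = p ^ n' := by simp
  rw [← h, h1] at h2
  exact (Nat.pow_le_pow_iff_right hp.one_lt).1 h2

lemma dvd_aux {n : ℕ} (d d' : Fin n → ℕ)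
    (hd : ∀ i, 2 ≤ d i) (hch : ∀ i j, i ≤ j → d i ∣ d j)
    (h : ∀ k, ∏ i, (d i).gcd k = ∏ i, (d' i).gcd k) (i : Fin n)
    (hi : ∀ j < i, d j = d' j) : d i ∣ d' i := by
  have hpos : 0 < d i := by have := hd i; omega
  by_contra hcon
  have hlt : ∏ j, (d' j).gcd (d i) < ∏ j, (d j).gcd (d i) := by
    apply Finset.prod_lt_prod
    · intro j _; exact Nat.gcd_pos_of_pos_right _ hpos
    · intro j _
      rcases lt_or_ge j i with hj | hj
      · rw [hi j hj]
      · rw [Nat.gcd_eq_right (hch i j hj)]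
        exact Nat.gcd_le_right _ hpos
    · refine ⟨i, Finset.mem_univ _, ?_⟩
      rw [Nat.gcd_self]
      refine lt_of_le_of_ne (Nat.gcd_le_right _ hpos) ?_
      intro he
      exact hcon (Nat.gcd_eq_right_iff_dvd.1 he)
  rw [h] at hlt
  exact lt_irrefl _ hlt

lemma chain_unique (p q : Σ n : ℕ, Fin n → ℕ)
    (hp : ∀ i, 2 ≤ p.2 i) (hpc : ∀ i j, i ≤ j → p.2 i ∣ p.2 j)
    (hq : ∀ i, 2 ≤ q.2 i) (hqc : ∀ i j, i ≤ j → q.2 i ∣ q.2 j)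
    (h : ∀ k, ∏ i, (p.2 i).gcd k = ∏ i, (q.2 i).gcd k) : p = q := by
  obtain ⟨n, d⟩ := p
  obtain ⟨n', d'⟩ := q
  have hn : n = n' := le_antisymm (len_le d d' hp hpc h)
    (len_le d' d hq hqc fun k => (h k).symm)
  subst hn
  congr 1
  funext i
  induction i using WellFoundedLT.induction with
  | _ i ih =>
  exact Nat.dvd_antisymm (dvd_aux d d' hp hpc h i ih)
    (dvd_aux d' d hq hqc (fun k => (h k).symm) i fun j hj => (ih j hj).symm)

lemma exists_pi_hom {K : Type} [AddCommGroup K] {n : ℕ} (d : Fin n → ℕ) (hd : ∀ i, 2 ≤ d i)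
    (A : Fin n → K) (hA : ∀ i, d i • A i = 0) :
    ∃ F : ((i : Fin n) → ZMod (d i)) →+ K,
      (∀ a, F a = ∑ i, (a i).val • A i) ∧
      ∀ m : Fin n → ℤ, F (fun i => (m i : ZMod (d i))) = ∑ i, m i • A i := by
  let f : ∀ i, ZMod (d i) →+ K := fun i =>
    ZMod.lift (d i) ⟨zmultiplesHom K (A i), by simp [hA]⟩
  have hf : ∀ i (m : ℤ), f i (m : ZMod (d i)) = m • A i := by
    intro i m
    simp [f]
  have hF : ∀ a, (∑ i, (f i).comp (Pi.evalAddMonoidHom _ i)) a = ∑ i, f i (a i) := by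
    intro a
    rw [AddMonoidHom.finsetSum_apply]; rfl
  refine ⟨∑ i, (f i).comp (Pi.evalAddMonoidHom _ i), fun a => ?_, fun m => ?_⟩
  · rw [hF]
    refine Finset.sum_congr rfl fun i _ => ?_
    have : NeZero (d i) := ⟨by have := hd i; omega⟩
    have h := hf i ((a i).val : ℤ)
    rw [natCast_zsmul] at h
    rw [← h]
    simp
  · rw [hF]
    exact Finset.sum_congr rfl fun i _ => hf i (m i)

lemma exists_standard {K : Type} [AddCommGroup K] [Finite K]
    (W : K →+ K →+ Additive Circle) (halt : ∀ x, W x x = 0)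
    (hnd : ∀ x, (∀ y, W x y = 0) → x = 0) :
    ∃ (n : ℕ) (d : Fin n → ℕ), (∀ i, 2 ≤ d i) ∧ (∀ i j, i ≤ j → d i ∣ d j) ∧
      ∃ e : K ≃+ (((i : Fin n) → ZMod (d i)) × ((i : Fin n) → ZMod (d i))),
        ∀ x y : K, W x y = ∑ i, (((e x).2 i).val * ((e y).1 i).val
          - ((e x).1 i).val * ((e y).2 i).val : ℤ) • zt (d i) := by
  have hskew : ∀ x y, W x y = - W y x := by
    intro x y
    have := halt (x + y)
    simp only [map_add, AddMonoidHom.add_apply, halt, zero_add, add_zero] at this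
    exact eq_neg_of_add_eq_zero_left (by simpa [add_comm] using this)
  obtain ⟨n, d, A, B, h2, hch, hdA, hdB, hAA, hBB, hBA1, hBA2, hgen⟩ :=
    exists_symplectic_basis _ K W halt hnd rfl
  obtain ⟨F, hF, hF'⟩ := exists_pi_hom d h2 A hdA
  obtain ⟨G, hG, hG'⟩ := exists_pi_hom d h2 B hdB
  have e1 : ∀ a j, W (F a) (A j) = 0 := by
    intro a j
    simp [hF, map_sum, AddMonoidHom.finsetSum_apply, hAA]
  have e2 : ∀ a j, W (G a) (B j) = 0 := by
    intro a j
    simp [hG, map_sum, AddMonoidHom.finsetSum_apply, hBB]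
  have e3 : ∀ a j, W (G a) (A j) = (a j).val • zt (d j) := by
    intro a j
    rw [hG, map_sum, AddMonoidHom.finsetSum_apply, Finset.sum_eq_single j]
    · simp [hBA1]
    · intro i _ hij
      simp [hBA2 i j hij]
    · simp
  have e4 : ∀ a j, W (F a) (B j) = -((a j).val • zt (d j)) := by
    intro a j
    rw [hF, map_sum, AddMonoidHom.finsetSum_apply, Finset.sum_eq_single j]
    · simp [hskew (A j) (B j), hBA1]
    · intro i _ hij
      simp [hskew (A i) (B j), hBA2 j i hij.symm]
    · simp
  have hval : ∀ j (z : ZMod (d j)), z.val • zt (d j) = 0 → z = 0 := by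
    intro j z hz
    have : NeZero (d j) := ⟨by have := h2 j; omega⟩
    have h := (zt_zsmul_eq_zero (d := d j) (NeZero.ne _) z.val).1
      (by rw [natCast_zsmul]; exact hz)
    have h' : d j ∣ z.val := by exact_mod_cast h
    exact (ZMod.val_eq_zero z).1 (Nat.eq_zero_of_dvd_of_lt h' (ZMod.val_lt z))
  have hbij : Function.Bijective (F.coprod G) := by
    constructor
    · rw [injective_iff_map_eq_zero]
      rintro ⟨a, b⟩ h
      rw [AddMonoidHom.coprod_apply] at h
      ext j
      · have := congrArg (fun z => W z (B j)) h
        simp only [map_add, AddMonoidHom.add_apply, e2, e4, map_zero,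
          AddMonoidHom.zero_apply, add_zero, neg_eq_zero] at this
        simpa using hval j _ this
      · have := congrArg (fun z => W z (A j)) h
        simp only [map_add, AddMonoidHom.add_apply, e1, e3, map_zero,
          AddMonoidHom.zero_apply, zero_add] at this
        simpa using hval j _ this
    · intro x
      obtain ⟨a, b, rfl⟩ := hgen x
      refine ⟨(fun i => (a i : ZMod (d i)), fun i => (b i : ZMod (d i))), ?_⟩
      rw [AddMonoidHom.coprod_apply, hF', hG']
  let e := AddEquiv.ofBijective (F.coprod G) hbij
  refine ⟨n, d, h2, hch, e.symm, fun x y => ?_⟩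
  obtain ⟨⟨a, b⟩, rfl⟩ := e.surjective x
  obtain ⟨⟨u, v⟩, rfl⟩ := e.surjective y
  simp only [AddEquiv.symm_apply_apply]
  have he : ∀ s t, e (s, t) = F s + G t := fun s t => rfl
  rw [he, he, hF u, hG v, map_add (W _), map_sum (W _), map_sum (W _), ← Finset.sum_add_distrib]
  refine Finset.sum_congr rfl fun i _ => ?_
  rw [map_nsmul, map_nsmul, map_add, AddMonoidHom.add_apply, AddMonoidHom.add_apply, e1, e2, e3, e4,
    zero_add, add_zero, sub_zsmul, mul_comm, mul_zsmul, mul_comm ((a i).val : ℤ), mul_zsmul]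
  simp only [natCast_zsmul, smul_neg]

lemma toMul_sum_zt {n : ℕ} (d : Fin n → ℕ) (m : Fin n → ℤ) :
    (∑ i, m i • zt (d i)).toMul = Circle.exp (2 * π * ∑ i, (m i : ℝ) / d i) := by
  have h : ∀ s : Finset (Fin n), (∑ i ∈ s, m i • zt (d i))
      = Additive.ofMul (Circle.exp (2 * π * ∑ i ∈ s, (m i : ℝ) / d i)) := by
    intro s
    induction s using Finset.induction_on with
    | empty => simp
    | insert a s ha ih =>
      rw [Finset.sum_insert ha, Finset.sum_insert ha, ih, mul_add, Circle.exp_add, ofMul_mul]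
      congr 1
      have : m a • zt (d a) = Additive.ofMul (Circle.exp (m a * (2 * π / d a))) := by
        rw [Circle.exp_intCast_mul]; rfl
      rw [this]
      congr 2
      ring
  rw [h, toMul_ofMul]

/-- classification of finite symplectic abelian groups.
A non-trivial finite abelian group `K` with a non-degenerate alternating
bihomomorphism `ω : K × K → U(1)` is isomorphic, as a symplectic abelian group,
to a unique standard symplectic abelian group `(K_D, ω_D)` with
`D = diag(d₁, …, dₙ)`, `2 ≤ d₁ ∣ d₂ ∣ ⋯ ∣ dₙ`. -/
theorem stmt0 {K : Type} [AddCommGroup K] [Fintype K] [Nontrivial K]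
    (ω : K → K → Circle)
    (hbil₁ : ∀ x y z : K, ω (x + y) z = ω x z * ω y z)
    (hbil₂ : ∀ x y z : K, ω x (y + z) = ω x y * ω x z)
    (halt : ∀ x : K, ω x x = 1)
    (hnd : ∀ x : K, (∀ y : K, ω x y = 1) → x = 0) :
    ∃! p : Σ n : ℕ, Fin n → ℕ,
      (∀ i, 2 ≤ p.2 i) ∧
      (∀ i j : Fin p.1, i ≤ j → p.2 i ∣ p.2 j) ∧
      ∃ e : K ≃+ (((i : Fin p.1) → ZMod (p.2 i)) × ((i : Fin p.1) → ZMod (p.2 i))),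
        ∀ x y : K,
          ω x y = Circle.exp (2 * π * ∑ i : Fin p.1,
            ((((e x).2 i).val * (((e y).1 i).val : ℝ)
              - (((e x).1 i).val : ℝ) * (((e y).2 i).val : ℝ)) / (p.2 i))) := by
  let W : K →+ K →+ Additive Circle :=
    AddMonoidHom.mk' (fun x => AddMonoidHom.mk' (fun y => Additive.ofMul (ω x y))
      (fun y z => by rw [hbil₂, ofMul_mul]))
      (fun x y => by
        refine AddMonoidHom.ext fun z => ?_
        exact congrArg Additive.ofMul (hbil₁ x y z))
  have hW : ∀ x y, W x y = Additive.ofMul (ω x y) := fun x y => rfl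
  obtain ⟨n, d, h2, hch, e, he⟩ := exists_standard W
    (fun x => by rw [hW, halt, ofMul_one])
    (fun x hx => hnd x fun y => by
      have := hx y
      rwa [hW, ofMul_eq_zero] at this)
  refine ⟨⟨n, d⟩, ⟨h2, hch, e, fun x y => ?_⟩, ?_⟩
  · have h := congrArg Additive.toMul (he x y)
    rw [toMul_sum_zt, hW, toMul_ofMul] at h
    rw [h]
    push_cast
    rfl
  · rintro q ⟨hq2, hqc, e', -⟩
    refine chain_unique q ⟨n, d⟩ hq2 hqc h2 hch fun k => ?_
    have h1 := card_ker_eq q.2 hq2 e' k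
    have h3 := card_ker_eq d h2 e k
    exact Nat.pow_left_injective (n := 2) (by norm_num) (h1.symm.trans h3)
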